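/- Let ℱ be the fractal structure on [0,1] whose level n is Γ_n = {[k/2^{nd}, (1+k)/2^{nd}] : k = 0,1,…,2^{nd}−1}, let 𝒢 be the natural fractal structure on [0,1]^d, and let α : [0,1] → [0,1]^d be a function between the GF-spaces ([0,1],ℱ) and ([0,1]^d,𝒢) with α(ℱ) = 𝒢, i.e., level n of 𝒢 is {α(A) : A ∈ Γ_n} (indexed by Γ_n). Then for every F ⊆ [0,1]^d, the lower (resp. upper) box dimension of F equals d times the lower (resp. upper) box dimension of α⁻¹(F). In particular, dim_B(F) exists if and only if dim_B(α⁻¹(F)) exists, and then dim_B(F) = d·dim_B(α⁻¹(F)). -/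

import Mathlib

open Filter Set MeasureTheory
open scoped ENNReal NNReal Topology

/-- A fractal structure on `X`: a countable family of coverings (levels, given as indexed
families so that sets may appear with multiplicity) such that each level refines the previous
one and every element of a level is the union of the elements of the next level contained
in it. -/
def IsFractalStructure {X : Type*} {ι : ℕ → Type*} (Γ : ∀ n : ℕ, ι n → Set X) : Prop :=
  (∀ n : ℕ, (⋃ i, Γ n i) = Set.univ) ∧
  (∀ (n : ℕ) (i : ι (n + 1)), ∃ j : ι n, Γ (n + 1) i ⊆ Γ n j) ∧
  (∀ (n : ℕ) (j : ι n), Γ n j = ⋃ i ∈ {i : ι (n + 1) | Γ (n + 1) i ⊆ Γ n j}, Γ (n + 1) i)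

/-- `N_n(F)`: the number of elements (counted with multiplicity) of level `n` meeting `F`. -/
noncomputable def Ncount {X : Type*} {ι : ℕ → Type*} (Γ : ∀ n : ℕ, ι n → Set X) (n : ℕ)
    (F : Set X) : ℕ :=
  Nat.card {i : ι n // (Γ n i ∩ F).Nonempty}

/-- The lower fractal dimension I of `F` with respect to the fractal structure `Γ`:
`liminf_n log N_n(F) / (n log 2)`. -/
noncomputable def dim1Lower {X : Type*} {ι : ℕ → Type*} (Γ : ∀ n : ℕ, ι n → Set X)
    (F : Set X) : ℝ :=
  Filter.liminf (fun n : ℕ => Real.log (Ncount Γ n F) / (n * Real.log 2)) Filter.atTop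

/-- The upper fractal dimension I of `F` with respect to the fractal structure `Γ`. -/
noncomputable def dim1Upper {X : Type*} {ι : ℕ → Type*} (Γ : ∀ n : ℕ, ι n → Set X)
    (F : Set X) : ℝ :=
  Filter.limsup (fun n : ℕ => Real.log (Ncount Γ n F) / (n * Real.log 2)) Filter.atTop

/-- `diam (F, Γ_n)`: the sup of the diameters of the level-`n` elements meeting `F`. -/
noncomputable def famDiam {X : Type*} [PseudoMetricSpace X] {ι : ℕ → Type*}
    (Γ : ∀ n : ℕ, ι n → Set X) (n : ℕ) (F : Set X) : ℝ :=
  ⨆ i : {i : ι n // (Γ n i ∩ F).Nonempty}, Metric.diam (Γ n i.1)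

/-- `diam (Γ_n)`: the sup of the diameters of the level-`n` elements. -/
noncomputable def levelDiam {X : Type*} [PseudoMetricSpace X] {ι : ℕ → Type*}
    (Γ : ∀ n : ℕ, ι n → Set X) (n : ℕ) : ℝ :=
  ⨆ i : ι n, Metric.diam (Γ n i)

/-- The lower fractal dimension II of `F` with respect to the fractal structure `Γ`:
`liminf_n log N_n(F) / (-log diam (F, Γ_n))`. -/
noncomputable def dim2Lower {X : Type*} [PseudoMetricSpace X] {ι : ℕ → Type*}
    (Γ : ∀ n : ℕ, ι n → Set X) (F : Set X) : ℝ :=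
  Filter.liminf (fun n : ℕ => Real.log (Ncount Γ n F) / (-Real.log (famDiam Γ n F)))
    Filter.atTop

/-- The upper fractal dimension II of `F` with respect to the fractal structure `Γ`. -/
noncomputable def dim2Upper {X : Type*} [PseudoMetricSpace X] {ι : ℕ → Type*}
    (Γ : ∀ n : ℕ, ι n → Set X) (F : Set X) : ℝ :=
  Filter.limsup (fun n : ℕ => Real.log (Ncount Γ n F) / (-Real.log (famDiam Γ n F)))
    Filter.atTop

/-- `H^s_{n,3}(F) = inf { Σ_{A ∈ 𝒜_l(F)} diam(A)^s : l ≥ n }`. -/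
noncomputable def H3n {X : Type*} [PseudoMetricSpace X] {ι : ℕ → Type*}
    (Γ : ∀ n : ℕ, ι n → Set X) (n : ℕ) (F : Set X) (s : ℝ) : ℝ≥0∞ :=
  ⨅ l ∈ {l : ℕ | n ≤ l},
    ∑' i : {i : ι l // (Γ l i ∩ F).Nonempty}, ENNReal.ofReal (Metric.diam (Γ l i.1) ^ s)

/-- `H^s_3(F) = lim_n H^s_{n,3}(F)` (the sequence is nondecreasing in `n`, so the limit is
the supremum). -/
noncomputable def H3 {X : Type*} [PseudoMetricSpace X] {ι : ℕ → Type*}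
    (Γ : ∀ n : ℕ, ι n → Set X) (F : Set X) (s : ℝ) : ℝ≥0∞ :=
  ⨆ n : ℕ, H3n Γ n F s

/-- Fractal dimension III: the critical exponent of `s ↦ H^s_3(F)`. -/
noncomputable def dim3 {X : Type*} [PseudoMetricSpace X] {ι : ℕ → Type*}
    (Γ : ∀ n : ℕ, ι n → Set X) (F : Set X) : ℝ≥0∞ :=
  ⨆ (s : ℝ≥0) (_ : H3 Γ F (s : ℝ) = ∞), (s : ℝ≥0∞)

/-- `H^s_{n,4}(F)`: infimum of `Σ diam(A_i)^s` over finite coverings of `F` by elements of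
levels `≥ n`. -/
noncomputable def H4n {X : Type*} [PseudoMetricSpace X] {ι : ℕ → Type*}
    (Γ : ∀ n : ℕ, ι n → Set X) (n : ℕ) (F : Set X) (s : ℝ) : ℝ≥0∞ :=
  ⨅ (U : Set (Σ l : ℕ, ι l)) (_ : U.Finite) (_ : ∀ p ∈ U, n ≤ p.1)
      (_ : F ⊆ ⋃ p ∈ U, Γ p.1 p.2),
    ∑' p : U, ENNReal.ofReal (Metric.diam (Γ p.1.1 p.1.2) ^ s)

/-- `H^s_4(F) = lim_n H^s_{n,4}(F)`. -/
noncomputable def H4 {X : Type*} [PseudoMetricSpace X] {ι : ℕ → Type*}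
    (Γ : ∀ n : ℕ, ι n → Set X) (F : Set X) (s : ℝ) : ℝ≥0∞ :=
  ⨆ n : ℕ, H4n Γ n F s

/-- Fractal dimension IV: the critical exponent of `s ↦ H^s_4(F)`. -/
noncomputable def dim4 {X : Type*} [PseudoMetricSpace X] {ι : ℕ → Type*}
    (Γ : ∀ n : ℕ, ι n → Set X) (F : Set X) : ℝ≥0∞ :=
  ⨆ (s : ℝ≥0) (_ : H4 Γ F (s : ℝ) = ∞), (s : ℝ≥0∞)

/-- `H^s_{n,5}(F)`: infimum of `Σ diam(A_i)^s` over countable coverings of `F` by elements of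
levels `≥ n`. -/
noncomputable def H5n {X : Type*} [PseudoMetricSpace X] {ι : ℕ → Type*}
    (Γ : ∀ n : ℕ, ι n → Set X) (n : ℕ) (F : Set X) (s : ℝ) : ℝ≥0∞ :=
  ⨅ (U : Set (Σ l : ℕ, ι l)) (_ : U.Countable) (_ : ∀ p ∈ U, n ≤ p.1)
      (_ : F ⊆ ⋃ p ∈ U, Γ p.1 p.2),
    ∑' p : U, ENNReal.ofReal (Metric.diam (Γ p.1.1 p.1.2) ^ s)

/-- `H^s_5(F) = lim_n H^s_{n,5}(F)`. -/
noncomputable def H5 {X : Type*} [PseudoMetricSpace X] {ι : ℕ → Type*}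
    (Γ : ∀ n : ℕ, ι n → Set X) (F : Set X) (s : ℝ) : ℝ≥0∞ :=
  ⨆ n : ℕ, H5n Γ n F s

/-- Fractal dimension V: the critical exponent of `s ↦ H^s_5(F)`. -/
noncomputable def dim5 {X : Type*} [PseudoMetricSpace X] {ι : ℕ → Type*}
    (Γ : ∀ n : ℕ, ι n → Set X) (F : Set X) : ℝ≥0∞ :=
  ⨆ (s : ℝ≥0) (_ : H5 Γ F (s : ℝ) = ∞), (s : ℝ≥0∞)

/-- The κ-condition: there is `κ ∈ ℕ` such that, for every `n`, any set of diameter at most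
`diam (Γ_n)` meets at most `κ` elements of level `n`. -/
def KCondition {X : Type*} [PseudoMetricSpace X] {ι : ℕ → Type*}
    (Γ : ∀ n : ℕ, ι n → Set X) : Prop :=
  ∃ κ : ℕ, ∀ (n : ℕ) (A : Set X), Metric.diam A ≤ levelDiam Γ n →
    {i : ι n | (Γ n i ∩ A).Nonempty}.encard ≤ (κ : ℕ∞)

/-- Finitely splitting: there is `κ' ∈ ℕ` bounding the number of elements of level `n+1`
contained in any element of level `n`. -/
def FinitelySplitting {X : Type*} {ι : ℕ → Type*} (Γ : ∀ n : ℕ, ι n → Set X) : Prop :=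
  ∃ κ' : ℕ, ∀ (n : ℕ) (j : ι n), {i : ι (n + 1) | Γ (n + 1) i ⊆ Γ n j}.encard ≤ (κ' : ℕ∞)

/-- The unit cube `[0,1]^d`. -/
def unitCube (d : ℕ) : Set (Fin d → ℝ) := Set.Icc 0 1

/-- The dyadic cube `∏_j [k_j/2^n, (k_j+1)/2^n]` inside `[0,1]^d`. -/
def dyadicCube (d n : ℕ) (k : Fin d → ℕ) : Set ↥(unitCube d) :=
  {y : ↥(unitCube d) |
    ∀ j : Fin d, (k j : ℝ) / 2 ^ n ≤ y.1 j ∧ y.1 j ≤ ((k j : ℝ) + 1) / 2 ^ n}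

/-- `Δ` is (as a family of sets) the natural fractal structure on `[0,1]^d`: its level `n`
consists exactly of the dyadic cubes of generation `n`. -/
def IsNaturalOnCube {d : ℕ} {ι : ℕ → Type*} (Δ : ∀ n : ℕ, ι n → Set ↥(unitCube d)) : Prop :=
  ∀ n : ℕ, Set.range (Δ n) =
    {C : Set ↥(unitCube d) | ∃ k : Fin d → ℕ, (∀ j, k j < 2 ^ n) ∧ C = dyadicCube d n k}

/-- `N_δ(F)`: the number of cubes of the grid of side `δ` in `ℝ^d` that meet `F`. -/
noncomputable def gridCount (d : ℕ) (F : Set (Fin d → ℝ)) (δ : ℝ) : ℕ :=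
  Nat.card {k : Fin d → ℤ | ∃ x ∈ F, ∀ j, (k j : ℝ) * δ ≤ x j ∧ x j ≤ ((k j : ℝ) + 1) * δ}

/-- The lower box dimension of `F ⊆ ℝ^d` (via grid counting). -/
noncomputable def gridBoxLower (d : ℕ) (F : Set (Fin d → ℝ)) : ℝ :=
  Filter.liminf (fun δ : ℝ => Real.log (gridCount d F δ) / (-Real.log δ)) (𝓝[>] (0 : ℝ))

/-- The upper box dimension of `F ⊆ ℝ^d` (via grid counting). -/
noncomputable def gridBoxUpper (d : ℕ) (F : Set (Fin d → ℝ)) : ℝ :=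
  Filter.limsup (fun δ : ℝ => Real.log (gridCount d F δ) / (-Real.log δ)) (𝓝[>] (0 : ℝ))

/-- `N_δ(F)` for `F ⊆ ℝ`: the number of intervals of the grid of side `δ` that meet `F`. -/
noncomputable def gridCount1 (F : Set ℝ) (δ : ℝ) : ℕ :=
  Nat.card {k : ℤ | ∃ x ∈ F, (k : ℝ) * δ ≤ x ∧ x ≤ ((k : ℝ) + 1) * δ}

/-- The lower box dimension of `F ⊆ ℝ` (via grid counting). -/
noncomputable def gridBox1Lower (F : Set ℝ) : ℝ :=
  Filter.liminf (fun δ : ℝ => Real.log (gridCount1 F δ) / (-Real.log δ)) (𝓝[>] (0 : ℝ))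

/-- The upper box dimension of `F ⊆ ℝ` (via grid counting). -/
noncomputable def gridBox1Upper (F : Set ℝ) : ℝ :=
  Filter.limsup (fun δ : ℝ => Real.log (gridCount1 F δ) / (-Real.log δ)) (𝓝[>] (0 : ℝ))

/-- `N_δ(F)`: the smallest number of sets of diameter at most `δ` needed to cover `F`. -/
noncomputable def coverCount {X : Type*} [PseudoMetricSpace X] (F : Set X) (δ : ℝ) : ℕ :=
  sInf {m : ℕ | ∃ U : Fin m → Set X, (∀ i, Metric.diam (U i) ≤ δ) ∧ F ⊆ ⋃ i, U i}

/-- The lower box dimension of a subset of a metric space. -/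
noncomputable def boxDimLower {X : Type*} [PseudoMetricSpace X] (F : Set X) : ℝ :=
  Filter.liminf (fun δ : ℝ => Real.log (coverCount F δ) / (-Real.log δ)) (𝓝[>] (0 : ℝ))

/-- The upper box dimension of a subset of a metric space. -/
noncomputable def boxDimUpper {X : Type*} [PseudoMetricSpace X] (F : Set X) : ℝ :=
  Filter.limsup (fun δ : ℝ => Real.log (coverCount F δ) / (-Real.log δ)) (𝓝[>] (0 : ℝ))

lemma sSup_le_of_eps {A B : Set ℝ} (h1 : ∀ ε > 0, ∀ a ∈ A, a - ε ∈ B)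
    (h2 : ∀ ε > 0, ∀ b ∈ B, b - ε ∈ A) : sSup A ≤ sSup B := by
  rcases A.eq_empty_or_nonempty with hA | hA
  · have : B = ∅ := by
      rw [Set.eq_empty_iff_forall_notMem]
      intro b hb
      have := h2 1 one_pos b hb
      rw [hA] at this
      exact this
    rw [hA, this]
  · by_cases hB : BddAbove B
    · refine csSup_le hA fun a ha => ?_
      refine le_of_forall_pos_le_add fun ε hε => ?_
      have := le_csSup hB (h1 ε hε a ha)
      linarith
    · have hA' : ¬ BddAbove A := by
        rintro ⟨M, hM⟩
        refine hB ⟨M + 1, fun b hb => ?_⟩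
        have := hM (h2 1 one_pos b hb)
        linarith
      rw [Real.sSup_of_not_bddAbove hB, Real.sSup_of_not_bddAbove hA']

lemma sSup_eq_of_eps {A B : Set ℝ} (h1 : ∀ ε > 0, ∀ a ∈ A, a - ε ∈ B)
    (h2 : ∀ ε > 0, ∀ b ∈ B, b - ε ∈ A) : sSup A = sSup B :=
  le_antisymm (sSup_le_of_eps h1 h2) (sSup_le_of_eps h2 h1)

lemma liminf_eq_of_tendsto {β : Type*} {l : Filter β} {f g : β → ℝ}
    (h : ∀ ε > 0, ∀ᶠ x in l, |f x - g x| ≤ ε) : liminf f l = liminf g l := by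
  rw [liminf_eq, liminf_eq]
  apply sSup_eq_of_eps
  · intro ε hε a ha
    simp only [Set.mem_ofPred_eq] at ha ⊢
    filter_upwards [ha, h ε hε] with x h1 h2
    rw [abs_le] at h2
    linarith
  · intro ε hε a ha
    simp only [Set.mem_ofPred_eq] at ha ⊢
    filter_upwards [ha, h ε hε] with x h1 h2
    rw [abs_le] at h2
    linarith

lemma limsup_eq_of_tendsto {β : Type*} {l : Filter β} {f g : β → ℝ}
    (h : ∀ ε > 0, ∀ᶠ x in l, |f x - g x| ≤ ε) : limsup f l = limsup g l := by
  rw [limsup_eq, limsup_eq, Real.sInf_def, Real.sInf_def]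
  congr 1
  apply sSup_eq_of_eps
  · intro ε hε a ha
    simp only [Set.mem_ofPred_eq, Set.mem_neg] at ha ⊢
    filter_upwards [ha, h ε hε] with x h1 h2
    rw [abs_le] at h2
    linarith
  · intro ε hε a ha
    simp only [Set.mem_ofPred_eq, Set.mem_neg] at ha ⊢
    filter_upwards [ha, h ε hε] with x h1 h2
    rw [abs_le] at h2
    linarith

lemma liminf_const_mul' {β : Type*} {l : Filter β} {f : β → ℝ} {c : ℝ} (hc : 0 < c) :
    liminf (fun x => c * f x) l = c * liminf f l := by
  rw [liminf_eq, liminf_eq, ← smul_eq_mul, ← Real.sSup_smul_of_nonneg hc.le]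
  congr 1
  ext a
  rw [Set.mem_smul_set_iff_inv_smul_mem₀ hc.ne']
  simp only [Set.mem_ofPred_eq, smul_eq_mul, inv_mul_le_iff₀ hc]

lemma limsup_const_mul' {β : Type*} {l : Filter β} {f : β → ℝ} {c : ℝ} (hc : 0 < c) :
    limsup (fun x => c * f x) l = c * limsup f l := by
  rw [limsup_eq, limsup_eq, ← smul_eq_mul, ← Real.sInf_smul_of_nonneg hc.le]
  congr 1
  ext a
  rw [Set.mem_smul_set_iff_inv_smul_mem₀ hc.ne']
  simp only [Set.mem_ofPred_eq, smul_eq_mul, le_inv_mul_iff₀ hc]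

lemma map_pow_nhdsGT (d : ℕ) (hd : d ≠ 0) :
    Filter.map (fun δ : ℝ => δ ^ d) (𝓝[>] (0 : ℝ)) = 𝓝[>] (0 : ℝ) := by
  have hd' : (0 : ℝ) < d := by positivity
  apply le_antisymm
  · refine tendsto_nhdsWithin_iff.2 ⟨?_, ?_⟩
    · have : Tendsto (fun δ : ℝ => δ ^ d) (𝓝 0) (𝓝 (0 ^ d)) := (continuous_pow d).tendsto 0
      rw [zero_pow hd] at this
      exact this.mono_left nhdsWithin_le_nhds
    · filter_upwards [self_mem_nhdsWithin] with x hx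
      exact pow_pos (Set.mem_Ioi.1 hx) d
  · have h1 : Tendsto (fun δ : ℝ => δ ^ ((d : ℝ)⁻¹)) (𝓝[>] (0 : ℝ)) (𝓝[>] (0 : ℝ)) := by
      refine tendsto_nhdsWithin_iff.2 ⟨?_, ?_⟩
      · have : Tendsto (fun δ : ℝ => δ ^ ((d : ℝ)⁻¹)) (𝓝 0) (𝓝 (0 ^ ((d : ℝ)⁻¹))) :=
          (Real.continuous_rpow_const (by positivity)).tendsto 0
        rw [Real.zero_rpow (by positivity)] at this
        exact this.mono_left nhdsWithin_le_nhds
      · filter_upwards [self_mem_nhdsWithin] with x hx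
        exact Real.rpow_pos_of_pos (Set.mem_Ioi.1 hx) _
    have h2 : Filter.map (fun δ : ℝ => δ ^ d)
        (Filter.map (fun δ : ℝ => δ ^ ((d : ℝ)⁻¹)) (𝓝[>] (0 : ℝ))) = 𝓝[>] (0 : ℝ) := by
      rw [Filter.map_map]
      conv_rhs => rw [← Filter.map_id (f := 𝓝[>] (0 : ℝ))]
      apply Filter.map_congr
      filter_upwards [self_mem_nhdsWithin] with x hx
      simp only [Function.comp, id]
      exact Real.rpow_inv_natCast_pow (le_of_lt hx) hd
    calc 𝓝[>] (0 : ℝ) = _ := h2.symm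
      _ ≤ _ := Filter.map_mono h1

/-- Counting lemma. -/
lemma box_count {K I : Type*} {d : ℕ} (m : K → Fin d → ℤ) (hm : Function.Injective m)
    (a : I → Fin d → ℝ) (S : Set K) (T : Set I) (hT : T.Finite) {δ s : ℝ} (hδ : 0 < δ)
    (C : ℕ) (hC : s ≤ C * δ)
    (h : ∀ k ∈ S, ∃ i ∈ T, ∃ x : Fin d → ℝ,
      (∀ j, (m k j : ℝ) * δ ≤ x j ∧ x j ≤ ((m k j : ℝ) + 1) * δ) ∧
      (∀ j, a i j ≤ x j ∧ x j ≤ a i j + s)) :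
    S.Finite ∧ Nat.card S ≤ (C + 2) ^ d * Nat.card T := by
  classical
  let B : I → Finset (Fin d → ℤ) := fun i =>
    Fintype.piFinset fun j => Finset.Icc (⌊a i j / δ⌋ - 1) (⌊a i j / δ⌋ + C)
  have hB : ∀ i, (B i).card = (C + 2) ^ d := by
    intro i
    simp only [B, Fintype.card_piFinset, Int.card_Icc]
    rw [Finset.prod_congr rfl (g := fun _ => C + 2) (fun j _ => by omega)]
    simp
  let U : Finset (Fin d → ℤ) := hT.toFinset.biUnion B
  have hU : m '' S ⊆ (U : Set (Fin d → ℤ)) := by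
    rintro _ ⟨k, hk, rfl⟩
    obtain ⟨i, hi, x, hx1, hx2⟩ := h k hk
    simp only [U, Finset.coe_biUnion, Set.mem_iUnion]
    refine ⟨i, by simpa using hi, ?_⟩
    simp only [B, Finset.mem_coe, Fintype.mem_piFinset, Finset.mem_Icc]
    intro j
    obtain ⟨h1, h2⟩ := hx1 j
    obtain ⟨h3, h4⟩ := hx2 j
    constructor
    · have : a i j / δ ≤ m k j + 1 := by
        rw [div_le_iff₀ hδ]; linarith
      have h5 := (Int.floor_le (a i j / δ)).trans this
      have h6 : ⌊a i j / δ⌋ ≤ m k j + 1 := by exact_mod_cast h5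
      omega
    · have : ((m k j - C : ℤ) : ℝ) ≤ a i j / δ := by
        rw [le_div_iff₀ hδ]; push_cast; nlinarith
      have := Int.le_floor.2 this
      omega
  have hfin : (m '' S).Finite := U.finite_toSet.subset hU
  refine ⟨hfin.of_finite_image hm.injOn, ?_⟩
  have h1 : Nat.card S = (m '' S).ncard := by
    rw [Set.ncard_image_of_injective _ hm]; rfl
  have h2 : Nat.card T = hT.toFinset.card := by
    rw [← Set.ncard_eq_toFinset_card T hT]; rfl
  rw [h1, h2]
  calc (m '' S).ncard ≤ (U : Set (Fin d → ℤ)).ncard := Set.ncard_le_ncard hU U.finite_toSet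
    _ = U.card := Set.ncard_coe_finset U
    _ ≤ hT.toFinset.card * (C + 2) ^ d := Finset.card_biUnion_le_card_mul _ _ _ fun i _ => (hB i).le
    _ = _ := mul_comm _ _

lemma log_sub_le {a b c : ℕ} (hc : 1 ≤ c) (h1 : a ≤ c * b) (h2 : b ≤ c * a) :
    |Real.log a - Real.log b| ≤ Real.log c := by
  have key : ∀ a b : ℕ, a ≤ c * b → b ≤ c * a → Real.log a - Real.log b ≤ Real.log c := by
    intro a b h1 h2
    rcases Nat.eq_zero_or_pos b with hb | hb
    · have ha : a = 0 := by subst hb; simpa using h1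
      subst ha; subst hb
      simpa using Real.log_natCast_nonneg c
    · have ha : 0 < a := by
        rcases Nat.eq_zero_or_pos a with ha | ha
        · subst ha; omega
        · exact ha
      have hb' : (0 : ℝ) < b := by exact_mod_cast hb
      have ha' : (0 : ℝ) < a := by exact_mod_cast ha
      have hc' : (0 : ℝ) < c := by exact_mod_cast hc
      have := Real.log_le_log ha' (show (a : ℝ) ≤ c * b by exact_mod_cast h1)
      rw [Real.log_mul hc'.ne' hb'.ne'] at this
      linarith
  rw [abs_le]
  have := key a b h1 h2
  have := key b a h2 h1
  constructor <;> linarith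

lemma dyadicCube_le {d n : ℕ} {k k' : Fin d → ℕ} (hk : ∀ j, k j < 2 ^ n)
    (h : dyadicCube d n k ⊆ dyadicCube d n k') : ∀ j, k' j ≤ k j := by
  intro j
  have h2 : (0 : ℝ) < 2 ^ n := by positivity
  have hmem : (fun j => (k j : ℝ) / 2 ^ n) ∈ unitCube d := by
    constructor
    · intro j; simp only [Pi.zero_apply]; positivity
    · intro j
      simp only [Pi.one_apply]
      rw [div_le_one h2]
      exact_mod_cast (hk j).le
  have := h (show (⟨_, hmem⟩ : unitCube d) ∈ dyadicCube d n k from fun j => by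
    constructor
    · exact le_rfl
    · simp only; gcongr; linarith)
  have := (this j).1
  simp only at this
  rw [div_le_div_iff_of_pos_right h2] at this
  exact_mod_cast this

lemma exists_index {d n : ℕ} {Δ : Fin (2 ^ (n * d)) → Set ↥(unitCube d)}
    (h : Set.range Δ =
    {C : Set ↥(unitCube d) | ∃ k : Fin d → ℕ, (∀ j, k j < 2 ^ n) ∧ C = dyadicCube d n k}) :
    ∃ φ : Fin (2 ^ (n * d)) → Fin d → ℕ, Function.Injective φ ∧
      ∀ i, Δ i = dyadicCube d n (φ i) := by
  have h1 : ∀ k : Fin d → Fin (2 ^ n), ∃ i, Δ i = dyadicCube d n (fun j => (k j : ℕ)) := by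
    intro k
    have : dyadicCube d n (fun j => (k j : ℕ)) ∈ Set.range Δ := by
      rw [h]; exact ⟨_, fun j => (k j).2, rfl⟩
    exact this
  choose ψ hψ using h1
  have hinj : Function.Injective ψ := by
    intro k k' hkk
    have e : dyadicCube d n (fun j => (k j : ℕ)) = dyadicCube d n (fun j => (k' j : ℕ)) := by
      rw [← hψ, ← hψ, hkk]
    funext j
    apply Fin.ext
    exact le_antisymm (dyadicCube_le (fun j => (k' j).2) e.ge j)
      (dyadicCube_le (fun j => (k j).2) e.le j)
  have hbij : Function.Bijective ψ := by
    rw [Fintype.bijective_iff_injective_and_card]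
    refine ⟨hinj, ?_⟩
    simp [pow_mul]
  let e := Equiv.ofBijective ψ hbij
  refine ⟨fun i j => (e.symm i j : ℕ), ?_, ?_⟩
  · intro i i' hii
    apply e.symm.injective
    funext j
    exact Fin.ext (congrFun hii j)
  · intro i
    rw [← hψ (e.symm i)]
    congr 1
    exact (e.apply_symm_apply i).symm

lemma exists_level {δ : ℝ} (h0 : 0 < δ) (h1 : δ ≤ 1) :
    ∃ n : ℕ, (1 / 2 ^ n : ℝ) ≤ 2 * δ ∧ δ ≤ 1 / 2 ^ n := by
  obtain ⟨n, hn1, hn2⟩ := exists_nat_pow_near_of_lt_one h0 h1 (y := (1 / 2 : ℝ)) (by norm_num)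
    (by norm_num)
  refine ⟨n, ?_, ?_⟩
  · rw [pow_succ, one_div_pow] at hn1
    linarith
  · rwa [one_div_pow] at hn2

lemma exists_box {δ : ℝ} (hδ : 0 < δ) (x : ℝ) :
    (⌊x / δ⌋ : ℝ) * δ ≤ x ∧ x ≤ ((⌊x / δ⌋ : ℝ) + 1) * δ := by
  constructor
  · rw [← le_div_iff₀ hδ]; exact Int.floor_le _
  · rw [← div_le_iff₀ hδ]; exact (Int.lt_floor_add_one _).le

/-- if `ℱ` is the fractal structure on `[0,1]` whose level `n` consists of the
intervals `[k/2^{nd}, (k+1)/2^{nd}]`, and `𝒢 = α(ℱ)` is the natural fractal structure on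
`[0,1]^d`, then for every `F ⊆ [0,1]^d` the (lower/upper) box dimension of `F` equals `d`
times the (lower/upper) box dimension of `α⁻¹(F)`; in particular one exists iff the other
does, and then `dim_B(F) = d · dim_B(α⁻¹(F))`. -/
theorem boxDim_eq_boxDim_preimage (d : ℕ)
    (Γ : ∀ n : ℕ, Fin (2 ^ (n * d)) → Set ↥unitInterval)
    (hΓdef : ∀ (n : ℕ) (k : Fin (2 ^ (n * d))),
      Γ n k = {x : ↥unitInterval |
        (k.1 : ℝ) / 2 ^ (n * d) ≤ x.1 ∧ x.1 ≤ ((k.1 : ℝ) + 1) / 2 ^ (n * d)})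
    (α : ↥unitInterval → ↥(unitCube d))
    (hΓ : IsFractalStructure Γ)
    (hΔ : IsFractalStructure (fun n i => α '' Γ n i))
    (hnat : IsNaturalOnCube (fun n i => α '' Γ n i))
    (F : Set ↥(unitCube d)) :
    gridBoxLower d (Subtype.val '' F) = d * gridBox1Lower (Subtype.val '' (α ⁻¹' F)) ∧
    gridBoxUpper d (Subtype.val '' F) = d * gridBox1Upper (Subtype.val '' (α ⁻¹' F)) := by
  rcases Nat.eq_zero_or_pos d with hd | hd
  · subst hd
    have hz : ∀ δ, Real.log (gridCount 0 (Subtype.val '' F) δ) = 0 := by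
      intro δ
      have : gridCount 0 (Subtype.val '' F) δ ≤ 1 := by
        unfold gridCount
        exact Finite.card_le_one_iff_subsingleton.2 inferInstance
      interval_cases gridCount 0 (Subtype.val '' F) δ <;> simp
    constructor
    · simp [gridBoxLower, hz]
    · simp [gridBoxUpper, hz]
  set G : Set (Fin d → ℝ) := Subtype.val '' F with hG
  set H : Set ℝ := Subtype.val '' (α ⁻¹' F) with hH
  -- comparison of the counts
  have hcount : ∃ c : ℕ, 1 ≤ c ∧ ∀ δ : ℝ, 0 < δ → δ ≤ 1 →
      gridCount d G δ ≤ c * gridCount1 H (δ ^ d) ∧ gridCount1 H (δ ^ d) ≤ c * gridCount d G δ := by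
    refine ⟨4 ^ d * 3 + (2 ^ d + 2) * 3 ^ d, ?_, ?_⟩
    · have : 0 < 4 ^ d := by positivity
      omega
    intro δ h0 h1
    obtain ⟨n, hn1, hn2⟩ := exists_level h0 h1
    obtain ⟨φ, hφ, hφΓ⟩ := exists_index (hnat n)
    simp only at hφΓ
    have hp : (0 : ℝ) < 1 / 2 ^ n := by positivity
    have hδd : 0 < δ ^ d := by positivity
    have hpd : (0 : ℝ) < 1 / 2 ^ (n * d) := by positivity
    have hpow : (1 / 2 ^ (n * d) : ℝ) = (1 / 2 ^ n) ^ d := by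
      rw [one_div_pow, pow_mul]
    let T : Set (Fin (2 ^ (n * d))) := {i | (Γ n i ∩ α ⁻¹' F).Nonempty}
    have hT : T.Finite := Set.toFinite T
    let S : Set (Fin d → ℤ) :=
      {k | ∃ x ∈ G, ∀ j, (k j : ℝ) * δ ≤ x j ∧ x j ≤ ((k j : ℝ) + 1) * δ}
    let R : Set ℤ :=
      {k : ℤ | ∃ x ∈ H, (k : ℝ) * δ ^ d ≤ x ∧ x ≤ ((k : ℝ) + 1) * δ ^ d}
    have A1 := box_count (d := d) (fun k : Fin d → ℤ => k) (fun _ _ h => h)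
      (fun i j => (φ i j : ℝ) / 2 ^ n) S T hT h0 2 (s := 1 / 2 ^ n) (by exact_mod_cast hn1) (by
        rintro k ⟨_, ⟨x, hxF, rfl⟩, hx⟩
        have hx' : x ∈ ⋃ i, α '' Γ n i := by rw [hΔ.1 n]; trivial
        obtain ⟨i, hi⟩ := Set.mem_iUnion.1 hx'
        have hi' := hi
        obtain ⟨t, ht, rfl⟩ := hi'
        rw [hφΓ] at hi
        refine ⟨i, ⟨t, ht, hxF⟩, _, hx, fun j => ?_⟩
        have := hi j
        rwa [add_div] at this)
    have A2 := box_count (d := d) (fun i j => (φ i j : ℤ))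
      (fun i i' h => hφ (funext fun j => Int.ofNat.inj (congrFun h j)))
      (fun (k : Fin d → ℤ) j => (k j : ℝ) * δ) T S A1.1 hp 1 (s := δ) (by simpa using hn2) (by
        rintro i ⟨t, ht, htF⟩
        refine ⟨fun j => ⌊(α t).1 j / δ⌋, ⟨(α t).1, ⟨_, htF, rfl⟩, fun j => exists_box h0 _⟩,
          (α t).1, fun j => ?_, fun j => ?_⟩
        · have : α t ∈ dyadicCube d n (φ i) := by rw [← hφΓ]; exact ⟨t, ht, rfl⟩
          have := this j
          simpa [div_eq_mul_inv] using this
        · have := exists_box h0 ((α t).1 j)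
          rwa [add_mul, one_mul] at this)
    have B1 := box_count (d := 1) (fun (k : ℤ) _ => k) (fun _ _ h => congrFun h 0)
      (fun (i : Fin (2 ^ (n * d))) _ => ((i : ℕ) : ℝ) / 2 ^ (n * d)) R T hT hδd (2 ^ d) (s := 1 / 2 ^ (n * d)) (by
        rw [hpow]; push_cast; rw [← mul_pow]; exact pow_le_pow_left₀ hp.le hn1 d) (by
        rintro k ⟨_, ⟨x, hxF, rfl⟩, hx⟩
        have hx' : x ∈ ⋃ i, Γ n i := by rw [hΓ.1 n]; trivial
        obtain ⟨i, hi⟩ := Set.mem_iUnion.1 hx'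
        refine ⟨i, ⟨x, hi, hxF⟩, fun _ => x.1, fun _ => hx, fun j => ?_⟩
        rw [hΓdef] at hi
        have := hi
        rwa [Set.mem_ofPred_eq, add_div] at this)
    have B2 := box_count (d := 1) (fun (i : Fin (2 ^ (n * d))) _ => ((i : ℕ) : ℤ))
      (fun i i' h => Fin.ext (Int.ofNat.inj (congrFun h 0)))
      (fun (k : ℤ) _ => (k : ℝ) * δ ^ d) T R B1.1 hpd 1 (s := δ ^ d) (by
        rw [hpow]; simpa using pow_le_pow_left₀ h0.le hn2 d) (by
        rintro i ⟨t, ht, htF⟩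
        refine ⟨⌊t.1 / δ ^ d⌋, ⟨t.1, ⟨_, htF, rfl⟩, exists_box hδd _⟩,
          fun _ => t.1, fun j => ?_, fun j => ?_⟩
        · rw [hΓdef] at ht
          simpa [div_eq_mul_inv] using ht
        · have := exists_box hδd t.1
          rwa [add_mul, one_mul] at this)
    have eS : gridCount d G δ = Nat.card S := rfl
    have eR : gridCount1 H (δ ^ d) = Nat.card R := rfl
    rw [eS, eR]
    have a1 := A1.2
    have a2 := A2.2
    have b1 := B1.2
    have b2 := B2.2
    generalize Nat.card S = s at *
    generalize Nat.card R = r at *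
    generalize Nat.card T = t at *
    norm_num at a1 a2 b1 b2
    constructor
    · calc s ≤ 4 ^ d * t := a1
        _ ≤ 4 ^ d * (3 * r) := by gcongr
        _ ≤ _ := by rw [add_mul, ← mul_assoc]; exact Nat.le_add_right _ _
    · calc r ≤ (2 ^ d + 2) * t := b1
        _ ≤ (2 ^ d + 2) * (3 ^ d * s) := by gcongr
        _ ≤ _ := by rw [add_mul (4 ^ d * 3), ← mul_assoc]; exact Nat.le_add_left _ _
  obtain ⟨c, hc, hcount⟩ := hcount
  have hd' : (0 : ℝ) < d := by exact_mod_cast hd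
  have hlog : Tendsto (fun δ : ℝ => -Real.log δ) (𝓝[>] 0) atTop :=
    tendsto_neg_atBot_atTop.comp Real.tendsto_log_nhdsGT_zero
  have hclose : ∀ ε > 0, ∀ᶠ δ in 𝓝[>] (0 : ℝ),
      |Real.log (gridCount d G δ) / (-Real.log δ) -
        d * (Real.log (gridCount1 H (δ ^ d)) / (-Real.log (δ ^ d)))| ≤ ε := by
    intro ε hε
    filter_upwards [self_mem_nhdsWithin, hlog.eventually_ge_atTop (Real.log c / ε),
      hlog.eventually_gt_atTop 0] with δ h0 h1 h2
    have h0' : 0 < δ := h0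
    have hδ1 : δ ≤ 1 := by
      by_contra hcon
      have := Real.log_pos (not_le.1 hcon)
      linarith
    obtain ⟨g1, g2⟩ := hcount δ h0' hδ1
    have := log_sub_le hc g1 g2
    have e : (d : ℝ) * (Real.log (gridCount1 H (δ ^ d)) / (-Real.log (δ ^ d))) =
        Real.log (gridCount1 H (δ ^ d)) / (-Real.log δ) := by
      rw [Real.log_pow, ← mul_neg, ← mul_div_assoc, mul_div_mul_left _ _ hd'.ne']
    rw [e, ← sub_div, abs_div, abs_of_pos h2, div_le_iff₀ h2]
    rw [div_le_iff₀ hε] at h1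
    linarith
  constructor
  · unfold gridBoxLower gridBox1Lower
    rw [liminf_eq_of_tendsto hclose, liminf_const_mul' hd']
    congr 1
    conv_rhs => rw [← map_pow_nhdsGT d hd.ne']
    rfl
  · unfold gridBoxUpper gridBox1Upper
    rw [limsup_eq_of_tendsto hclose, limsup_const_mul' hd']
    congr 1
    conv_rhs => rw [← map_pow_nhdsGT d hd.ne']
    rfl
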